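/- Every stream has an ordering: for every stream S = (T, v) with T = [t1, tm] and every c1 ∈ ℕ, there exists a tick stream Ṡ = (K, v̇) with pairwise distinct atoms per time point whose tick pattern begins with the tick (t1, c1) and whose underlying stream is S. -/

import Mathlib

namespace Ticker

/-- A tick: a pair of a time and a count. -/
abbrev Tick := ℕ × ℕ

/-- `k'` is the time increment or the count increment of `k`. -/
def TickStep (k k' : Tick) : Prop := k' = (k.1 + 1, k.2) ∨ k' = (k.1, k.2 + 1)

/-- A tick pattern: a nonempty finite sequence of ticks where each successive tick is
either the time increment or the count increment of the previous one. -/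
def IsTickPattern (K : List Tick) : Prop := K ≠ [] ∧ K.Chain' TickStep

/-- A stream: a timeline `[t1, tm]` (a closed nonempty interval of ℕ) together with
an evaluation assigning a finite set of atoms to every time point, empty outside
the timeline. -/
structure TStream (A : Type) [DecidableEq A] where
  t1 : ℕ
  tm : ℕ
  le : t1 ≤ tm
  v : ℕ → Finset A
  outside : ∀ t, (t < t1 ∨ tm < t) → v t = ∅

variable {A : Type} [DecidableEq A]

/-- The tuple size `|S|` of a stream: the total number of (atom, time point) pairs. -/
def TStream.size (S : TStream A) : ℕ := ∑ t ∈ Finset.Icc S.t1 S.tm, (S.v t).card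

/-- The sliding time-based window `τ_n(S, t)` for size `n` at `t ∈ T`. -/
def TStream.timeWin (S : TStream A) (n t : ℕ) (ht : S.t1 ≤ t) : TStream A where
  t1 := max S.t1 (t - n)
  tm := t
  le := max_le ht (Nat.sub_le t n)
  v := fun u => if max S.t1 (t - n) ≤ u ∧ u ≤ t then S.v u else ∅
  outside := by
    intro u hu
    apply if_neg
    rintro ⟨h1, h2⟩
    rcases hu with h | h
    · exact absurd h1 (not_le.mpr h)
    · exact absurd h2 (not_le.mpr h)

/-- The left endpoint `t' = max ({ u ∈ T | |τ_{t-u}(S,t)| ≥ n } ∪ {t1})` used in the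
definition of sliding tuple-based windows. -/
def TStream.leftEP (S : TStream A) (n t : ℕ) (ht : S.t1 ≤ t) : ℕ :=
  (insert S.t1 ((Finset.Icc S.t1 t).filter fun u => n ≤ (S.timeWin (t - u) t ht).size)).max'
    (Finset.insert_nonempty _ _)

/-- `S'` is a sliding tuple-based window of `S` of size `n` at `t`. -/
def IsTupleWin (S : TStream A) (n t : ℕ) (ht : S.t1 ≤ t) (S' : TStream A) : Prop :=
  if (S.timeWin (t - S.leftEP n t ht) t ht).size ≤ n then
    S' = S.timeWin (t - S.leftEP n t ht) t ht
  else
    S'.t1 = S.leftEP n t ht ∧ S'.tm = t ∧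
    (∀ u, S.leftEP n t ht + 1 ≤ u → u ≤ t → S'.v u = S.v u) ∧
    S'.v (S.leftEP n t ht) ⊆ S.v (S.leftEP n t ht) ∧
    (∀ u, u < S.leftEP n t ht ∨ t < u → S'.v u = ∅) ∧
    S'.size = n

/-- A sequence of ticks together with an evaluation (no well-formedness conditions). -/
structure PreTick (A : Type) [DecidableEq A] where
  K : List Tick
  vdot : Tick → Finset A

/-- The time of the first tick. -/
def PreTick.t1 (P : PreTick A) : ℕ := (P.K.head?.getD (0, 0)).1

/-- The time of the last tick. -/
def PreTick.tm (P : PreTick A) : ℕ := (P.K.getLast?.getD (0, 0)).1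

/-- The count of the first tick. -/
def PreTick.c1 (P : PreTick A) : ℕ := (P.K.head?.getD (0, 0)).2

/-- The count of the last tick. -/
def PreTick.cm (P : PreTick A) : ℕ := (P.K.getLast?.getD (0, 0)).2

/-- All atoms evaluated at time `t`: the union `⋃ { v̇(t,c) : (t,c) ∈ K }`. -/
def PreTick.atTime (P : PreTick A) (t : ℕ) : Finset A :=
  ((P.K.filter fun k => decide (k.1 = t)).map P.vdot).foldr (· ∪ ·) ∅

/-- A tick stream: a tick pattern with an evaluation assigning the empty set to the
first tick, a singleton to every count increment, and the empty set to every time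
increment. -/
structure TickStream (A : Type) [DecidableEq A] extends PreTick A where
  ne : K ≠ []
  chain : K.Chain' TickStep
  init : ∀ k ∈ K.head?, vdot k = ∅
  incr : K.Chain' fun k k' => if k' = (k.1, k.2 + 1) then ∃ a, vdot k' = {a} else vdot k' = ∅

/-- The time window `τ_n` over tick streams: keep the ticks `(t', c')` with
`max(t1, tm − n) ≤ t' ≤ tm`, with the restricted evaluation. -/
def PreTick.timeWin (P : PreTick A) (n : ℕ) : PreTick A :=
  ⟨P.K.filter fun k => decide (max P.t1 (P.tm - n) ≤ k.1 ∧ k.1 ≤ P.tm), P.vdot⟩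

/-- The tuple window `#_n` over tick streams: keep the ticks `(t', c')` with
`max(c1, cm − n + 1) ≤ c' ≤ cm`, with the restricted evaluation. -/
def PreTick.tupleWin (P : PreTick A) (n : ℕ) : PreTick A :=
  ⟨P.K.filter fun k => decide (max P.c1 (P.cm + 1 - n) ≤ k.2 ∧ k.2 ≤ P.cm), P.vdot⟩

/-- The stream `S` underlies the tick data `(K, v̇)`: same endpoints of the timeline,
and the evaluation at every `t` is the union of the tick evaluations at time `t`. -/
def Underlies (S : TStream A) (P : PreTick A) : Prop :=
  (∃ k ∈ P.K.head?, S.t1 = k.1) ∧ (∃ k ∈ P.K.getLast?, S.tm = k.1) ∧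
    ∀ t, S.v t = P.atTime t

/-- Pairwise distinct atoms per time point: distinct ticks with the same time
component carry distinct atoms. -/
def DistinctPerTime (P : PreTick A) : Prop :=
  ∀ k ∈ P.K, ∀ k' ∈ P.K, k ≠ k' → k.1 = k'.1 →
    ∀ a a', P.vdot k = {a} → P.vdot k' = {a'} → a ≠ a'


theorem PreTick.mem_atTime (P : PreTick A) (t : ℕ) (a : A) :
    a ∈ P.atTime t ↔ ∃ k ∈ P.K, k.1 = t ∧ a ∈ P.vdot k := by
  have key : ∀ l : List Tick, a ∈ (l.map P.vdot).foldr (· ∪ ·) ∅ ↔ ∃ k ∈ l, a ∈ P.vdot k := by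
    intro l
    induction l with
    | nil => simp
    | cons x l ih => simp [ih]
  simp [PreTick.atTime, key, and_assoc]

/-- `P` starts at `k₁`, ends at `k`, no tick exceeds `k` in either component, atoms are distinct
per time point, and the underlying evaluation is `w`. -/
structure OrdersTo (P : TickStream A) (k₁ k : Tick) (w : ℕ → Finset A) : Prop where
  head : P.K.head? = some k₁
  last : P.K.getLast? = some k
  le_last : ∀ x ∈ P.K, x ≤ k
  distinct : DistinctPerTime P.toPreTick
  atTime_eq : ∀ t, P.atTime t = w t

/-- The tick stream consisting of a single tick without atoms. -/
def TickStream.single (k : Tick) : TickStream A where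
  K := [k]
  vdot := fun _ => ∅
  ne := by simp
  chain := List.isChain_singleton _
  init := by simp
  incr := List.isChain_singleton _

theorem ordersTo_single (k : Tick) :
    OrdersTo (TickStream.single k : TickStream A) k k (fun _ => ∅) where
  head := rfl
  last := rfl
  le_last := by simp [TickStream.single]
  distinct := by
    intro x hx y hy hne
    simp only [TickStream.single, List.mem_singleton] at hx hy
    exact absurd (hx.trans hy.symm) hne
  atTime_eq := by
    intro t
    ext a
    simp [PreTick.mem_atTime, TickStream.single]

theorem OrdersTo.exists_snoc {P : TickStream A} {k₁ k : Tick} {w : ℕ → Finset A}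
    (h : OrdersTo P k₁ k w) (k' : Tick) (s : Finset A) (hstep : TickStep k k')
    (hs : if k' = (k.1, k.2 + 1) then ∃ a, s = {a} else s = ∅)
    (hd : Disjoint s (w k'.1)) :
    ∃ P' : TickStream A, OrdersTo P' k₁ k' (Function.update w k'.1 (w k'.1 ∪ s)) := by
  have hlt : ¬ k' ≤ k ∧ k ≤ k' := by
    rcases hstep with rfl | rfl <;> simp [Prod.le_def]
  have hfresh : ∀ x ∈ P.K, x ≠ k' := fun x hx hxk => hlt.1 (hxk ▸ h.le_last x hx)
  have hv : ∀ x ∈ P.K, Function.update P.vdot k' s x = P.vdot x := fun x hx =>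
    Function.update_of_ne (hfresh x hx) _ _
  have hlast : ∀ x ∈ P.K.getLast?, x = k := by
    intro x hx
    simpa [h.last, eq_comm] using hx
  have hmem : ∀ x ∈ P.K, ∀ a ∈ P.vdot x, a ∈ w x.1 := fun x hx a ha =>
    h.atTime_eq x.1 ▸ (P.mem_atTime x.1 a).2 ⟨x, hx, rfl, ha⟩
  refine ⟨⟨⟨P.K ++ [k'], Function.update P.vdot k' s⟩, by simp, ?_, ?_, ?_⟩, ?_, ?_, ?_, ?_, ?_⟩
  · refine List.isChain_append.2 ⟨P.chain, by simp, ?_⟩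
    intro x hx y hy
    obtain rfl := hlast x hx
    simp only [List.head?_cons, Option.mem_some_iff] at hy
    exact hy ▸ hstep
  · intro x hx
    rw [List.head?_append_of_ne_nil _ P.ne] at hx
    exact (hv x (List.mem_of_mem_head? hx)).trans (P.init x hx)
  · refine List.isChain_append.2 ⟨?_, by simp, ?_⟩
    · refine List.IsChain.imp_of_mem_imp ?_ P.incr
      intro x y _ hy hxy
      simpa only [hv y hy] using hxy
    · intro x hx y hy
      obtain rfl := hlast x hx
      simp only [List.head?_cons, Option.mem_some_iff] at hy
      subst hy
      simpa using hs
  · simp [h.head]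
  · simp
  · intro x hx
    rcases List.mem_append.1 hx with hx | hx
    · exact (h.le_last x hx).trans hlt.2
    · exact (List.mem_singleton.1 hx).le
  · have hnew : ∀ x ∈ P.K, x.1 = k'.1 → ∀ a a', P.vdot x = {a} → s = {a'} → a ≠ a' := by
      rintro x hx hxk a a' ha ha' rfl
      have has : a ∈ s := by simp [ha']
      have haw : a ∈ w x.1 := hmem x hx a (by simp [ha])
      exact Finset.disjoint_left.1 hd has (hxk ▸ haw)
    intro x hx y hy hne hxy a a' ha ha'
    dsimp only at hx hy ha ha'
    rcases List.mem_append.1 hx with hxK | hxk <;> rcases List.mem_append.1 hy with hyK | hyk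
    · rw [hv x hxK] at ha
      rw [hv y hyK] at ha'
      exact h.distinct x hxK y hyK hne hxy a a' ha ha'
    · obtain rfl := List.mem_singleton.1 hyk
      rw [hv x hxK] at ha
      rw [Function.update_self] at ha'
      exact hnew x hxK hxy a a' ha ha'
    · obtain rfl := List.mem_singleton.1 hxk
      rw [hv y hyK] at ha'
      rw [Function.update_self] at ha
      exact (hnew y hyK hxy.symm a' a ha' ha).symm
    · exact absurd ((List.mem_singleton.1 hxk).trans (List.mem_singleton.1 hyk).symm) hne
  · intro t
    have hold : ∀ a, (∃ x ∈ P.K, x.1 = t ∧ a ∈ Function.update P.vdot k' s x) ↔ a ∈ w t := by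
      intro a
      rw [← h.atTime_eq, PreTick.mem_atTime]
      exact exists_congr fun x => and_congr_right fun hx => by rw [hv x hx]
    ext a
    simp only [PreTick.mem_atTime, List.mem_append, or_and_right, exists_or, hold,
      List.mem_singleton, exists_eq_left, Function.update_self]
    by_cases ht : t = k'.1
    · subst ht
      simp
    · simp [Function.update_of_ne ht, Ne.symm ht]

theorem OrdersTo.exists_union {P : TickStream A} {k₁ k : Tick} {w : ℕ → Finset A}
    (h : OrdersTo P k₁ k w) (s : Finset A) (hd : Disjoint s (w k.1)) :
    ∃ (P' : TickStream A) (c : ℕ),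
      OrdersTo P' k₁ (k.1, c) (Function.update w k.1 (w k.1 ∪ s)) := by
  induction s using Finset.induction_on with
  | empty => exact ⟨P, k.2, by simpa using h⟩
  | insert a s ha ih =>
    rw [Finset.disjoint_insert_left] at hd
    obtain ⟨P', c, h'⟩ := ih hd.2
    obtain ⟨P'', h''⟩ := h'.exists_snoc (k.1, c + 1) {a} (Or.inr rfl) (by simp)
      (by simp [hd.1, ha])
    refine ⟨P'', c + 1, ?_⟩
    have he : w k.1 ∪ s ∪ {a} = w k.1 ∪ insert a s := by
      ext x
      simp [or_comm]
    simpa [he] using h''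

theorem TStream.exists_ordersTo (S : TStream A) (c₁ t : ℕ) (ht : S.t1 ≤ t) :
    ∃ (P : TickStream A) (c : ℕ),
      OrdersTo P (S.t1, c₁) (t, c) (fun u => if u ≤ t then S.v u else ∅) := by
  induction t, ht using Nat.le_induction with
  | base =>
    obtain ⟨P, c, h⟩ := (ordersTo_single (A := A) (S.t1, c₁)).exists_union (S.v S.t1) (by simp)
    refine ⟨P, c, ?_⟩
    convert h using 1
    funext u
    rcases lt_trichotomy u S.t1 with hu | rfl | hu
    · simp [Function.update_of_ne hu.ne, S.outside u (Or.inl hu)]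
    · simp
    · simp [Function.update_of_ne hu.ne', hu.not_ge]
  | succ t _ ih =>
    obtain ⟨P, c, h⟩ := ih
    obtain ⟨P', h'⟩ := h.exists_snoc (t + 1, c) ∅ (Or.inl rfl) (by simp) (by simp)
    obtain ⟨P'', c', h''⟩ := h'.exists_union (S.v (t + 1)) (by simp)
    refine ⟨P'', c', ?_⟩
    convert h'' using 1
    funext u
    rcases lt_trichotomy u (t + 1) with hu | rfl | hu
    · simp [Function.update_of_ne hu.ne, hu.le, Nat.lt_succ_iff.1 hu]
    · simp
    · simp [Function.update_of_ne hu.ne', hu.not_ge, (Nat.lt_of_succ_lt hu).not_ge]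

/-- Every stream has an ordering: for every stream `S` and every
initial count `c1`, there is a tick stream with pairwise distinct atoms per time
point whose tick pattern begins with `(t1, c1)` and whose underlying stream is `S`. -/
theorem exists_ordering {A : Type} [Countable A] [DecidableEq A]
    (S : TStream A) (c1 : ℕ) :
    ∃ P : TickStream A, DistinctPerTime P.toPreTick ∧
      P.K.head? = some (S.t1, c1) ∧ Underlies S P.toPreTick := by
  obtain ⟨P, c, h⟩ := S.exists_ordersTo c1 S.tm S.le
  refine ⟨P, h.distinct, h.head, ⟨_, h.head, rfl⟩, ⟨_, h.last, rfl⟩, fun t => ?_⟩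
  rw [h.atTime_eq]
  split_ifs with ht
  · rfl
  · exact S.outside t (Or.inr (not_le.1 ht))

end Ticker
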